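/- For n ≥ 2 the relative trace tr_n satisfies: (i) tr_n(YZ) = tr_n(Y)·Z for all Y ∈ Y_{d,n}^B and Z ∈ Y_{d,n−1}^B; (ii) tr_n(XY) = X·tr_n(Y) for all X ∈ Y_{d,n−1}^B and Y ∈ Y_{d,n}^B; (iii) tr_n(XYZ) = X·tr_n(Y)·Z for all X, Z ∈ Y_{d,n−1}^B and Y ∈ Y_{d,n}^B. -/

import Mathlib

set_option maxHeartbeats 1000000
set_option synthInstance.maxHeartbeats 400000

noncomputable section

/-- The field `L = ℂ(u,v,z)` of rational functions in three indeterminates over `ℂ`. -/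
abbrev Kf : Type := FractionRing (MvPolynomial (Fin 3) ℂ)

/-- The indeterminate `u`. -/
def uu : Kf := algebraMap (MvPolynomial (Fin 3) ℂ) Kf (MvPolynomial.X 0)

/-- The indeterminate `v`. -/
def vv : Kf := algebraMap (MvPolynomial (Fin 3) ℂ) Kf (MvPolynomial.X 1)

/-- The indeterminate `z`. -/
def zz : Kf := algebraMap (MvPolynomial (Fin 3) ℂ) Kf (MvPolynomial.X 2)

/-- Generators of the framization of the Hecke algebra of type B on `n` strands:
`b` is the generator `b₁`, `g i` is the braiding generator `g_{i+1}` (`i : Fin (n-1)`),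
and `t j` is the framing generator `t_{j+1}` (`j : Fin n`). -/
inductive Gen (n : ℕ) : Type
  | b : Gen n
  | g : Fin (n - 1) → Gen n
  | t : Fin n → Gen n

/-- The free algebra on the generators. -/
abbrev FA (n : ℕ) : Type := FreeAlgebra Kf (Gen n)

/-- The generator `b₁` in the free algebra. -/
def Bb (n : ℕ) : FA n := FreeAlgebra.ι Kf Gen.b

/-- The generator `g_i` (for `1 ≤ i ≤ n-1`) in the free algebra; junk value `1` out of range. -/
def Gg (n i : ℕ) : FA n :=
  if h : 1 ≤ i ∧ i ≤ n - 1 then FreeAlgebra.ι Kf (Gen.g ⟨i - 1, by omega⟩) else 1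

/-- The generator `t_j` (for `1 ≤ j ≤ n`) in the free algebra; junk value `1` out of range. -/
def Tt (n j : ℕ) : FA n :=
  if h : 1 ≤ j ∧ j ≤ n then FreeAlgebra.ι Kf (Gen.t ⟨j - 1, by omega⟩) else 1

/-- The element `e_i = (1/d) ∑_{m=0}^{d-1} t_i^m t_{i+1}^{d-m}` in the free algebra. -/
def eF (d n i : ℕ) : FA n :=
  (d : Kf)⁻¹ • ∑ m ∈ Finset.range d, Tt n i ^ m * Tt n (i + 1) ^ (d - m)

/-- The element `f₁ = (1/d) ∑_{m=0}^{d-1} t₁^m` in the free algebra. -/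
def fF (d n : ℕ) : FA n :=
  (d : Kf)⁻¹ • ∑ m ∈ Finset.range d, Tt n 1 ^ m

/-- The action of the simple transposition `s_i` on indices: swaps `i` and `i+1`. -/
def sAct (i j : ℕ) : ℕ := if j = i then i + 1 else if j = i + 1 then i else j

/-- The defining relations of the framization `Y_{d,n}^B` of the Hecke algebra of type B. -/
inductive YBrel (d n : ℕ) : FA n → FA n → Prop
  | gg : ∀ i j : ℕ, 1 ≤ i → i ≤ n - 1 → 1 ≤ j → j ≤ n - 1 → (i + 1 < j ∨ j + 1 < i) →
      YBrel d n (Gg n i * Gg n j) (Gg n j * Gg n i)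
  | braid : ∀ i : ℕ, 1 ≤ i → i ≤ n - 2 →
      YBrel d n (Gg n i * Gg n (i + 1) * Gg n i) (Gg n (i + 1) * Gg n i * Gg n (i + 1))
  | bg : ∀ i : ℕ, 2 ≤ i → i ≤ n - 1 → YBrel d n (Bb n * Gg n i) (Gg n i * Bb n)
  | bgbg : YBrel d n (Bb n * Gg n 1 * Bb n * Gg n 1) (Gg n 1 * Bb n * Gg n 1 * Bb n)
  | tt : ∀ i j : ℕ, 1 ≤ i → i ≤ n → 1 ≤ j → j ≤ n →
      YBrel d n (Tt n i * Tt n j) (Tt n j * Tt n i)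
  | tg : ∀ i j : ℕ, 1 ≤ i → i ≤ n - 1 → 1 ≤ j → j ≤ n →
      YBrel d n (Tt n j * Gg n i) (Gg n i * Tt n (sAct i j))
  | tb : ∀ i : ℕ, 1 ≤ i → i ≤ n → YBrel d n (Tt n i * Bb n) (Bb n * Tt n i)
  | td : ∀ i : ℕ, 1 ≤ i → i ≤ n → YBrel d n (Tt n i ^ d) 1
  | gsq : ∀ i : ℕ, 1 ≤ i → i ≤ n - 1 →
      YBrel d n (Gg n i ^ 2) (1 + (uu - uu⁻¹) • (eF d n i * Gg n i))
  | bsq : YBrel d n (Bb n ^ 2) (1 + (vv - vv⁻¹) • (fF d n * Bb n))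

/-- The framization of the Hecke algebra of type B, `Y_{d,n}^B`. -/
abbrev YB (d n : ℕ) : Type := RingQuot (YBrel d n)

instance (d n : ℕ) : Ring (YB d n) := RingQuot.instRing (YBrel d n)

instance (d n : ℕ) : Algebra Kf (YB d n) := RingQuot.instAlgebra _

instance (d n : ℕ) : Module Kf (YB d n) := Algebra.toModule

/-- The canonical projection from the free algebra onto `Y_{d,n}^B`. -/
def mkY (d n : ℕ) : FA n →ₐ[Kf] YB d n := RingQuot.mkAlgHom Kf (YBrel d n)

/-- The generator `b₁` of `Y_{d,n}^B`. -/
def bY (d n : ℕ) : YB d n := mkY d n (Bb n)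

/-- The generator `g_i` of `Y_{d,n}^B`. -/
def gY (d n : ℕ) (i : ℕ) : YB d n := mkY d n (Gg n i)

/-- The generator `t_j` of `Y_{d,n}^B`. -/
def tY (d n : ℕ) (j : ℕ) : YB d n := mkY d n (Tt n j)

/-- The idempotent `e_i` of `Y_{d,n}^B`. -/
def eY (d n : ℕ) (i : ℕ) : YB d n := mkY d n (eF d n i)

/-- The idempotent `f₁` of `Y_{d,n}^B`. -/
def fY (d n : ℕ) : YB d n := mkY d n (fF d n)

/-- The element `g_i⁻¹ = g_i - (u - u⁻¹) e_i`. -/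
def gInv (d n i : ℕ) : YB d n := gY d n i - (uu - uu⁻¹) • eY d n i

/-- The elements `b_k := g_{k-1} ⋯ g_1 b_1 g_1⁻¹ ⋯ g_{k-1}⁻¹` for `2 ≤ k ≤ n`,
defined by `b_k = g_{k-1} b_{k-1} g_{k-1}⁻¹`; with `b_1` the generator `b₁`. -/
def bk (d n : ℕ) : ℕ → YB d n
  | 0 => 1
  | 1 => bY d n
  | (k + 2) => gY d n (k + 1) * bk d n (k + 1) * gInv d n (k + 1)

/-- The descending product `g_{k-1} g_{k-2} ⋯ g_j`. -/
def gRange (d n j k : ℕ) : YB d n := (((List.range' j (k - j)).reverse).map (gY d n)).prod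

/-- The elements `𝔪⁺_{k,j,m}`: `𝔪⁺_{k,k,m} = t_k^m` and
`𝔪⁺_{k,j,m} = g_{k-1} ⋯ g_j t_j^m` for `j < k`. -/
def mPlus (d n k j m : ℕ) : YB d n :=
  if j = k then tY d n k ^ m else gRange d n j k * tY d n j ^ m

/-- The elements `𝔪⁻_{k,j,m}`: `𝔪⁻_{k,k,m} = t_k^m b_k` and
`𝔪⁻_{k,j,m} = g_{k-1} ⋯ g_j b_j t_j^m` for `j < k`. -/
def mMinus (d n k j m : ℕ) : YB d n :=
  if j = k then tY d n k ^ m * bk d n k else gRange d n j k * (bk d n j * tY d n j ^ m)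

/-- The subsets `M_{d,k}` of `Y_{d,n}^B`:
`M_{d,1} = {t₁^m, t₁^m b₁}` and `M_{d,k} = {t_k^m, t_k^m b_k, g_{k-1} x : x ∈ M_{d,k-1}}`. -/
def Mset (d n : ℕ) : ℕ → Set (YB d n)
  | 0 => {1}
  | 1 => {x | ∃ m ≤ d - 1, x = tY d n 1 ^ m ∨ x = tY d n 1 ^ m * bY d n}
  | (k + 2) => {x |
      (∃ m ≤ d - 1, x = tY d n (k + 2) ^ m ∨ x = tY d n (k + 2) ^ m * bk d n (k + 2)) ∨
      ∃ y ∈ Mset d n (k + 1), x = gY d n (k + 1) * y}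

/-- The set `𝖢_n` of all products `𝔪_1 𝔪_2 ⋯ 𝔪_n` with `𝔪_i ∈ M_{d,i}`. -/
def Cset (d n : ℕ) : Set (YB d n) :=
  {x | ∃ f : Fin n → YB d n, (∀ i : Fin n, f i ∈ Mset d n (i.val + 1)) ∧
    x = (List.ofFn f).prod}

/-- Characterization of the natural inclusion `Y_{d,n}^B ⊆ Y_{d,n+1}^B`:
the algebra map sending generators to the generators of the same name. -/
def IsIncl (d n : ℕ) (inc : YB d n →ₐ[Kf] YB d (n + 1)) : Prop :=
  inc (bY d n) = bY d (n + 1) ∧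
  (∀ i, 1 ≤ i → i ≤ n - 1 → inc (gY d n i) = gY d (n + 1) i) ∧
  (∀ j, 1 ≤ j → j ≤ n → inc (tY d n j) = tY d (n + 1) j)

/-- Characterization of the relative trace `tr_{n+1} : Y_{d,n+1}^B → Y_{d,n}^B`
(with respect to trace parameters `x`, `y`): it is the `L`-linear map defined on the
basis `𝖢_{n+1}` by `tr(w t_{n+1}^m) = x_m w`, `tr(w b_{n+1} t_{n+1}^m) = y_m w`, and
`tr(w 𝔪^±_{n+1,k,m}) = z (w 𝔪^±_{n,k,m})` for `k < n+1`, where `w ∈ 𝖢_n`. -/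
def IsRelTrace (d : ℕ) (x y : ZMod d → Kf) (n : ℕ)
    (inc : YB d n →ₐ[Kf] YB d (n + 1)) (tr : YB d (n + 1) →ₗ[Kf] YB d n) : Prop :=
  ∀ w ∈ Cset d n, ∀ m : ℕ, m ≤ d - 1 →
    (tr (inc w * tY d (n + 1) (n + 1) ^ m) = x (m : ZMod d) • w) ∧
    (tr (inc w * (bk d (n + 1) (n + 1) * tY d (n + 1) (n + 1) ^ m)) = y (m : ZMod d) • w) ∧
    (∀ k, 1 ≤ k → k ≤ n →
      tr (inc w * mPlus d (n + 1) (n + 1) k m) = zz • (w * mPlus d n n k m) ∧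
      tr (inc w * mMinus d (n + 1) (n + 1) k m) = zz • (w * mMinus d n n k m))

/-- Characterization of the trace `tr_1 : Y_{d,1}^B → L`:
`tr_1(t₁^a) = x_a` and `tr_1(b₁ t₁^a) = y_a`. -/
def IsTr1 (d : ℕ) (x y : ZMod d → Kf) (tr1 : YB d 1 →ₗ[Kf] Kf) : Prop :=
  ∀ a : ℕ, a ≤ d - 1 →
    tr1 (tY d 1 1 ^ a) = x (a : ZMod d) ∧ tr1 (bY d 1 * tY d 1 1 ^ a) = y (a : ZMod d)

/-- The Markov trace tower `Tr_{m+1} = tr_1 ∘ tr_2 ∘ ⋯ ∘ tr_{m+1} : Y_{d,m+1}^B → L`,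
built from the relative traces (`tr k` here is the relative trace
`tr_{k+2} : Y_{d,k+2}^B → Y_{d,k+1}^B`). -/
def TrT (d : ℕ) (tr1 : YB d 1 →ₗ[Kf] Kf)
    (tr : (k : ℕ) → (YB d (k + 2) →ₗ[Kf] YB d (k + 1))) :
    (m : ℕ) → (YB d (m + 1) →ₗ[Kf] Kf)
  | 0 => tr1
  | (m + 1) => (TrT d tr1 tr m).comp (tr m)

section Relations

variable {d n : ℕ}

theorem mkY_eq_of_rel {a b : FA n} (h : YBrel d n a b) : mkY d n a = mkY d n b :=
  RingQuot.mkAlgHom_rel Kf h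

theorem gY_commute {i j : ℕ} (hi : 1 ≤ i) (hi' : i + 1 ≤ n) (hj : 1 ≤ j) (hj' : j + 1 ≤ n)
    (h : i + 1 < j ∨ j + 1 < i) : Commute (gY d n i) (gY d n j) := by
  have := mkY_eq_of_rel
    (YBrel.gg (d := d) (n := n) i j hi (by omega) hj (by omega) h)
  simpa only [gY, tY, bY, eY, Commute, SemiconjBy, map_mul] using this

theorem gY_braid {i : ℕ} (hi : 1 ≤ i) (hi' : i + 2 ≤ n) :
    gY d n i * gY d n (i + 1) * gY d n i = gY d n (i + 1) * gY d n i * gY d n (i + 1) := by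
  have := mkY_eq_of_rel (YBrel.braid (d := d) (n := n) i hi (by omega))
  simpa only [gY, tY, bY, eY, Commute, SemiconjBy, map_mul] using this

theorem bY_commute_gY {i : ℕ} (hi : 2 ≤ i) (hi' : i + 1 ≤ n) :
    Commute (bY d n) (gY d n i) := by
  have := mkY_eq_of_rel (YBrel.bg (d := d) (n := n) i hi (by omega))
  simpa only [gY, tY, bY, eY, Commute, SemiconjBy, map_mul] using this

theorem bY_gY_bY_gY :
    bY d n * gY d n 1 * bY d n * gY d n 1 = gY d n 1 * bY d n * gY d n 1 * bY d n := by
  have := mkY_eq_of_rel (YBrel.bgbg (d := d) (n := n))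
  simpa only [gY, tY, bY, eY, Commute, SemiconjBy, map_mul] using this

theorem tY_commute {i j : ℕ} (hi : 1 ≤ i) (hi' : i ≤ n) (hj : 1 ≤ j) (hj' : j ≤ n) :
    Commute (tY d n i) (tY d n j) := by
  have := mkY_eq_of_rel (YBrel.tt (d := d) (n := n) i j hi hi' hj hj')
  simpa only [gY, tY, bY, eY, Commute, SemiconjBy, map_mul] using this

theorem tY_mul_gY {i j : ℕ} (hi : 1 ≤ i) (hi' : i + 1 ≤ n) (hj : 1 ≤ j) (hj' : j ≤ n) :
    tY d n j * gY d n i = gY d n i * tY d n (sAct i j) := by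
  have := mkY_eq_of_rel (YBrel.tg (d := d) (n := n) i j hi (by omega) hj hj')
  simpa only [gY, tY, bY, eY, Commute, SemiconjBy, map_mul] using this

theorem tY_commute_bY {i : ℕ} (hi : 1 ≤ i) (hi' : i ≤ n) : Commute (tY d n i) (bY d n) := by
  have := mkY_eq_of_rel (YBrel.tb (d := d) (n := n) i hi hi')
  simpa only [gY, tY, bY, eY, Commute, SemiconjBy, map_mul] using this

theorem tY_pow_d {i : ℕ} (hi : 1 ≤ i) (hi' : i ≤ n) : tY d n i ^ d = 1 := by
  have := mkY_eq_of_rel (YBrel.td (d := d) (n := n) i hi hi')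
  simpa only [gY, tY, bY, eY, Commute, SemiconjBy, map_pow, map_one] using this

theorem eY_eq (i : ℕ) : eY d n i =
    (d : Kf)⁻¹ • ∑ m ∈ Finset.range d, tY d n i ^ m * tY d n (i + 1) ^ (d - m) := by
  simp only [eY, eF, map_smul, map_sum, map_mul, map_pow, tY]

theorem gY_sq {i : ℕ} (hi : 1 ≤ i) (hi' : i + 1 ≤ n) :
    gY d n i * gY d n i = 1 + (uu - uu⁻¹) • (eY d n i * gY d n i) := by
  have := mkY_eq_of_rel (YBrel.gsq (d := d) (n := n) i hi (by omega))
  simpa only [gY, tY, bY, eY, Commute, SemiconjBy, map_mul, map_pow, map_add, map_one, map_smul, sq] using this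

theorem bY_sq : bY d n * bY d n = 1 + (vv - vv⁻¹) •
    (((d : Kf)⁻¹ • ∑ m ∈ Finset.range d, tY d n 1 ^ m) * bY d n) := by
  have := mkY_eq_of_rel (YBrel.bsq (d := d) (n := n))
  simpa only [gY, tY, bY, eY, Commute, SemiconjBy, map_mul, map_pow, map_add, map_one, map_smul, sq, fF, map_sum] using this

theorem tY_succ_mul_gY {i : ℕ} (hi : 1 ≤ i) (hi' : i + 1 ≤ n) :
    SemiconjBy (gY d n i) (tY d n i) (tY d n (i + 1)) := by
  have := tY_mul_gY (d := d) (n := n) (j := i + 1) hi hi' (by omega) hi'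
  simpa [SemiconjBy, Commute, sAct] using this.symm

theorem tY_mul_gY_self {i : ℕ} (hi : 1 ≤ i) (hi' : i + 1 ≤ n) :
    SemiconjBy (gY d n i) (tY d n (i + 1)) (tY d n i) := by
  have := tY_mul_gY (d := d) (n := n) (j := i) hi hi' hi (by omega)
  simpa [SemiconjBy, Commute, sAct] using this.symm

theorem tY_commute_gY {i j : ℕ} (hi : 1 ≤ i) (hi' : i + 1 ≤ n) (hj : 1 ≤ j) (hj' : j ≤ n)
    (h : j ≠ i) (h' : j ≠ i + 1) : Commute (tY d n j) (gY d n i) := by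
  have := tY_mul_gY (d := d) (n := n) (j := j) hi hi' hj hj'
  simpa [SemiconjBy, Commute, sAct, h, h'] using this

theorem eY_commute_gY {i : ℕ} (hi : 1 ≤ i) (hi' : i + 1 ≤ n) :
    Commute (eY d n i) (gY d n i) := by
  have h1 : (∑ m ∈ Finset.range d, tY d n (i + 1) ^ m * tY d n i ^ (d - m)) =
      ∑ m ∈ Finset.range d, tY d n i ^ m * tY d n (i + 1) ^ (d - m) := by
    have e : ∀ a b : ℕ, a = i ∨ a = i + 1 → ∑ m ∈ Finset.range d, tY d n a ^ m * tY d n b ^ (d - m)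
        = ∑ m ∈ Finset.range (d + 1), tY d n a ^ m * tY d n b ^ (d - m) - 1 := by
      intro a b ha
      rw [Finset.sum_range_succ, tY_pow_d (by omega) (by omega)]
      simp
    rw [e _ _ (Or.inr rfl), e _ _ (Or.inl rfl), ← Finset.sum_range_reflect]
    congr 1
    refine Finset.sum_congr rfl fun m hm => ?_
    have hm' : m ≤ d := by simpa [Nat.lt_succ_iff] using hm
    rw [show d + 1 - 1 - m = d - m by omega, Nat.sub_sub_self hm']
    exact ((tY_commute (by omega) (by omega) (by omega) (by omega)).pow_pow _ _).eq
  have h2 : gY d n i * (∑ m ∈ Finset.range d, tY d n (i + 1) ^ m * tY d n i ^ (d - m)) =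
      (∑ m ∈ Finset.range d, tY d n i ^ m * tY d n (i + 1) ^ (d - m)) * gY d n i := by
    rw [Finset.mul_sum, Finset.sum_mul]
    refine Finset.sum_congr rfl fun m _ => ?_
    exact (((tY_mul_gY_self hi hi').pow_right m).mul_right
      ((tY_succ_mul_gY hi hi').pow_right (d - m))).eq
  rw [eY_eq]
  refine Commute.smul_left ?_ _
  rw [h1] at h2
  exact h2.symm

theorem gY_mul_gInv {i : ℕ} (hi : 1 ≤ i) (hi' : i + 1 ≤ n) : gY d n i * gInv d n i = 1 := by
  rw [gInv, mul_sub, mul_smul_comm, ← (eY_commute_gY hi hi').eq, gY_sq hi hi', add_sub_cancel_right]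

theorem gInv_mul_gY {i : ℕ} (hi : 1 ≤ i) (hi' : i + 1 ≤ n) : gInv d n i * gY d n i = 1 := by
  rw [gInv, sub_mul, smul_mul_assoc, gY_sq hi hi', add_sub_cancel_right]

end Relations

theorem SemiconjBy.symm_of_inverse {M : Type*} [Monoid M] {a b x y : M} (h : SemiconjBy a x y)
    (hab : a * b = 1) (hba : b * a = 1) : SemiconjBy b y x :=
  SemiconjBy.units_inv_symm_left (a := ⟨a, b, hab, hba⟩) h

/-- The generators of `Y_{d,n}^B` involving only the first `k` strands. -/
def strandGens (d n k : ℕ) : Set (YB d n) :=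
  {x | (1 ≤ k ∧ x = bY d n) ∨ (∃ i, 1 ≤ i ∧ i < k ∧ x = gY d n i) ∨
    ∃ j, 1 ≤ j ∧ j ≤ k ∧ x = tY d n j}

/-- The subalgebra of `Y_{d,n}^B` generated by the generators on the first `k` strands. -/
def strandAlg (d n k : ℕ) : Subalgebra Kf (YB d n) := Algebra.adjoin Kf (strandGens d n k)

/-- The product `g_1⁻¹ ⋯ g_{k-1}⁻¹`. -/
def ascInv (d n : ℕ) : ℕ → YB d n
  | 0 => 1
  | 1 => 1
  | (k + 2) => ascInv d n (k + 1) * gInv d n (k + 1)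

/-- The product `g_{k-1} ⋯ g_1`. -/
def descProd (d n : ℕ) : ℕ → YB d n
  | 0 => 1
  | 1 => 1
  | (k + 2) => gY d n (k + 1) * descProd d n (k + 1)

/-- The element `e_{1,k+1} · g_1⁻¹ ⋯ g_{k-1}⁻¹ g_k g_{k-1} ⋯ g_1`, which measures the failure of
`b_{k+1}` to commute with `b_1`. -/
def crossTerm (d n k : ℕ) : YB d n :=
  (d : Kf)⁻¹ • ∑ m ∈ Finset.range d,
    tY d n 1 ^ m * (ascInv d n k * gY d n k * descProd d n k) * tY d n 1 ^ (d - m)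

section StrandAlg

variable {d n k : ℕ}

theorem bY_mem (hk : 1 ≤ k) : bY d n ∈ strandAlg d n k :=
  Algebra.subset_adjoin (Or.inl ⟨hk, rfl⟩)

theorem gY_mem {i : ℕ} (hi : 1 ≤ i) (hk : i < k) : gY d n i ∈ strandAlg d n k :=
  Algebra.subset_adjoin (Or.inr (Or.inl ⟨i, hi, hk, rfl⟩))

theorem tY_mem {j : ℕ} (hj : 1 ≤ j) (hk : j ≤ k) : tY d n j ∈ strandAlg d n k :=
  Algebra.subset_adjoin (Or.inr (Or.inr ⟨j, hj, hk, rfl⟩))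

theorem eY_mem {i : ℕ} (hi : 1 ≤ i) (hk : i < k) : eY d n i ∈ strandAlg d n k := by
  rw [eY_eq]
  exact Subalgebra.smul_mem _ (Subalgebra.sum_mem _ fun m _ => mul_mem
    (pow_mem (tY_mem hi (by omega)) _) (pow_mem (tY_mem (by omega) (by omega)) _)) _

theorem gInv_mem {i : ℕ} (hi : 1 ≤ i) (hk : i < k) : gInv d n i ∈ strandAlg d n k :=
  sub_mem (gY_mem hi hk) (Subalgebra.smul_mem _ (eY_mem hi hk) _)

theorem strandAlg_mono {l : ℕ} (h : k ≤ l) : strandAlg d n k ≤ strandAlg d n l := by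
  refine Algebra.adjoin_mono ?_
  rintro x (⟨h1, rfl⟩ | ⟨i, h1, h2, rfl⟩ | ⟨j, h1, h2, rfl⟩)
  · exact Or.inl ⟨by omega, rfl⟩
  · exact Or.inr (Or.inl ⟨i, h1, by omega, rfl⟩)
  · exact Or.inr (Or.inr ⟨j, h1, by omega, rfl⟩)

theorem bk_succ (hk : 1 ≤ k) : bk d n (k + 1) = gY d n k * bk d n k * gInv d n k := by
  obtain ⟨k, rfl⟩ := Nat.exists_eq_add_of_le' hk
  rfl

theorem ascInv_succ (hk : 1 ≤ k) : ascInv d n (k + 1) = ascInv d n k * gInv d n k := by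
  obtain ⟨k, rfl⟩ := Nat.exists_eq_add_of_le' hk
  rfl

theorem descProd_succ (hk : 1 ≤ k) : descProd d n (k + 1) = gY d n k * descProd d n k := by
  obtain ⟨k, rfl⟩ := Nat.exists_eq_add_of_le' hk
  rfl

theorem bk_mem (hk : 1 ≤ k) : bk d n k ∈ strandAlg d n k := by
  induction k, hk using Nat.le_induction with
  | base => exact bY_mem le_rfl
  | succ k hk ih =>
    rw [bk_succ hk]
    exact mul_mem (mul_mem (gY_mem hk (by omega)) (strandAlg_mono (by omega) ih))
      (gInv_mem hk (by omega))

theorem ascInv_mem (hk : 1 ≤ k) : ascInv d n k ∈ strandAlg d n k := by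
  induction k, hk using Nat.le_induction with
  | base => exact one_mem _
  | succ k hk ih =>
    rw [ascInv_succ hk]
    exact mul_mem (strandAlg_mono (by omega) ih) (gInv_mem hk (by omega))

theorem descProd_mem (hk : 1 ≤ k) : descProd d n k ∈ strandAlg d n k := by
  induction k, hk using Nat.le_induction with
  | base => exact one_mem _
  | succ k hk ih =>
    rw [descProd_succ hk]
    exact mul_mem (gY_mem hk (by omega)) (strandAlg_mono (by omega) ih)

theorem ascInv_mul_descProd (hk : 1 ≤ k) (hn : k ≤ n) :
    ascInv d n k * descProd d n k = 1 := by
  induction k, hk using Nat.le_induction with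
  | base => exact one_mul 1
  | succ k hk ih =>
    rw [ascInv_succ hk, descProd_succ hk, mul_assoc, ← mul_assoc (gInv d n k),
      gInv_mul_gY hk hn, one_mul, ih (by omega)]

theorem descProd_semiconjBy (hk : 1 ≤ k) (hn : k ≤ n) :
    SemiconjBy (descProd d n k) (tY d n 1) (tY d n k) := by
  induction k, hk using Nat.le_induction with
  | base => exact SemiconjBy.one_left _
  | succ k hk ih =>
    rw [descProd_succ hk]
    exact (tY_succ_mul_gY hk hn).mul_left (ih (by omega))

theorem ascInv_mul_tY_pow_mul_descProd (hk : 1 ≤ k) (hn : k ≤ n) (a : ℕ) :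
    ascInv d n k * tY d n k ^ a * descProd d n k = tY d n 1 ^ a := by
  rw [mul_assoc, ← ((descProd_semiconjBy hk hn).pow_right a).eq, ← mul_assoc,
    ascInv_mul_descProd hk hn, one_mul]

theorem commute_strandAlg {x s : YB d n} (hb : 1 ≤ k → Commute x (bY d n))
    (hg : ∀ i, 1 ≤ i → i < k → Commute x (gY d n i))
    (ht : ∀ j, 1 ≤ j → j ≤ k → Commute x (tY d n j)) (hs : s ∈ strandAlg d n k) :
    Commute x s := by
  have : strandAlg d n k ≤ Subalgebra.centralizer Kf {x} := by
    refine Algebra.adjoin_le ?_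
    rintro y hy
    rw [SetLike.mem_coe, Subalgebra.mem_centralizer_iff]
    rintro _ rfl
    rcases hy with ⟨h1, rfl⟩ | ⟨i, h1, h2, rfl⟩ | ⟨j, h1, h2, rfl⟩
    · exact hb h1
    · exact hg i h1 h2
    · exact ht j h1 h2
  exact (Subalgebra.mem_centralizer_iff Kf).1 (this hs) x rfl

theorem tY_commute_strandAlg (hn : k + 1 ≤ n) {s : YB d n} (hs : s ∈ strandAlg d n k) :
    Commute (tY d n (k + 1)) s :=
  commute_strandAlg (fun _ => tY_commute_bY (by omega) hn)
    (fun i h1 h2 => tY_commute_gY h1 (by omega) (by omega) hn (by omega) (by omega))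
    (fun j h1 h2 => tY_commute (by omega) hn h1 (by omega)) hs

theorem gY_commute_strandAlg (hn : k + 2 ≤ n) {s : YB d n} (hs : s ∈ strandAlg d n k) :
    Commute (gY d n (k + 1)) s :=
  commute_strandAlg (fun _ => (bY_commute_gY (by omega) hn).symm)
    (fun i h1 h2 => gY_commute (by omega) hn h1 (by omega) (by omega))
    (fun j h1 h2 => (tY_commute_gY (by omega) hn h1 (by omega) (by omega) (by omega)).symm) hs

theorem gInv_commute {i : ℕ} (hi : 1 ≤ i) (hn : i + 1 ≤ n) {s : YB d n}
    (h : Commute (gY d n i) s) : Commute (gInv d n i) s :=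
  SemiconjBy.symm_of_inverse h (gY_mul_gInv hi hn) (gInv_mul_gY hi hn)

theorem tY_commute_bk {j : ℕ} (hk : 1 ≤ k) (hn : k ≤ n) (hj : 1 ≤ j) (hj' : j ≤ n) :
    Commute (tY d n j) (bk d n k) := by
  induction k, hk using Nat.le_induction generalizing j with
  | base => exact tY_commute_bY hj hj'
  | succ k hk ih =>
    rw [bk_succ hk]
    have h1 := tY_succ_mul_gY (d := d) hk hn
    have h2 := tY_mul_gY_self (d := d) hk hn
    have h1' := h1.symm_of_inverse (gY_mul_gInv hk hn) (gInv_mul_gY hk hn)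
    have h2' := h2.symm_of_inverse (gY_mul_gInv hk hn) (gInv_mul_gY hk hn)
    rcases eq_or_ne j k with rfl | hjk
    · exact ((h2.mul_left (ih (by omega) (by omega) hn).symm).mul_left h2').symm
    rcases eq_or_ne j (k + 1) with rfl | hjk'
    · exact ((h1.mul_left (ih (by omega) hk (by omega)).symm).mul_left h1').symm
    have h3 := tY_commute_gY (d := d) hk hn hj hj' hjk hjk'
    exact (h3.mul_right (ih (by omega) hj hj')).mul_right (gInv_commute hk hn h3.symm).symm

theorem gInv_braid {i : ℕ} (hi : 1 ≤ i) (hn : i + 2 ≤ n) :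
    gY d n (i + 1) * gY d n i * gInv d n (i + 1) = gInv d n i * gY d n (i + 1) * gY d n i := by
  have h1 := gY_braid (d := d) hi hn
  have h2 := gY_mul_gInv (d := d) (n := n) (i := i + 1) (by omega) hn
  have h3 := gInv_mul_gY (d := d) (n := n) (i := i) hi (by omega)
  calc gY d n (i + 1) * gY d n i * gInv d n (i + 1)
      = gInv d n i * (gY d n i * gY d n (i + 1) * gY d n i) * gInv d n (i + 1) := by
        simp only [← mul_assoc, h3, one_mul]
    _ = _ := by rw [h1]; simp only [mul_assoc, h2, mul_one]

theorem gInv_braid' {i : ℕ} (hi : 1 ≤ i) (hn : i + 2 ≤ n) :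
    gY d n (i + 1) * gInv d n i * gInv d n (i + 1) =
      gInv d n i * gInv d n (i + 1) * gY d n i := by
  have h1 := gInv_braid (d := d) hi hn
  have h2 := gY_mul_gInv (d := d) (n := n) (i := i) hi (by omega)
  have h3 := gInv_mul_gY (d := d) (n := n) (i := i + 1) (by omega) hn
  have h4 := gY_mul_gInv (d := d) (n := n) (i := i + 1) (by omega) hn
  have h5 := gInv_mul_gY (d := d) (n := n) (i := i) hi (by omega)
  have h6 : gY d n i * (gY d n (i + 1) * gInv d n i) * gInv d n (i + 1) =
      gInv d n (i + 1) * gY d n i := by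
    calc gY d n i * (gY d n (i + 1) * gInv d n i) * gInv d n (i + 1)
        = gInv d n (i + 1) * (gY d n (i + 1) * gY d n i * gY d n (i + 1)) *
            gInv d n i * gInv d n (i + 1) := by simp only [← mul_assoc, h3, one_mul]
      _ = gInv d n (i + 1) * gY d n i * gY d n (i + 1) * (gY d n i *
            gInv d n i) * gInv d n (i + 1) := by
          rw [← gY_braid hi hn]; simp only [mul_assoc]
      _ = _ := by rw [h2, mul_one, mul_assoc, h4, mul_one]
  rw [mul_assoc (gInv d n i), ← h6]
  simp only [← mul_assoc, h5, one_mul]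

theorem bk_commute_gY {i : ℕ} (hi : 1 ≤ i) (hik : i < k) (hn : k + 1 ≤ n) :
    Commute (bk d n (k + 1)) (gY d n i) := by
  have hk : 1 ≤ k := by omega
  induction k, hk using Nat.le_induction with
  | base => omega
  | succ k hk ih =>
    rw [bk_succ (by omega)]
    rcases Nat.lt_or_ge i k with h | h
    · have h3 : Commute (gY d n (k + 1)) (gY d n i) :=
        gY_commute (by omega) (by omega) hi (by omega) (by omega)
      exact (h3.mul_left (ih h (by omega))).mul_left (gInv_commute (by omega) (by omega) h3)
    · obtain rfl : i = k := by omega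
      have h2 : Commute (gY d n (i + 1)) (bk d n i) :=
        gY_commute_strandAlg (by omega) (bk_mem hi)
      have h5 := gInv_braid' (d := d) hi hn
      rw [bk_succ hi]
      change _ * _ = _ * _
      simp only [mul_assoc] at h5 ⊢
      rw [← h5, ← mul_assoc (bk d n i), ← h2.eq]
      simp only [← mul_assoc]
      rw [gY_braid hi hn]

theorem bk_mul_bY (hk : 1 ≤ k) (hn : k + 1 ≤ n) :
    bk d n (k + 1) * bY d n = bY d n * bk d n (k + 1) +
      (uu - uu⁻¹) • (bY d n * crossTerm d n k * bY d n - crossTerm d n k * bY d n * bY d n) := by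
  induction k, hk using Nat.le_induction with
  | base =>
    have h1 : crossTerm d n 1 = eY d n 1 * gY d n 1 := by
      rw [crossTerm, eY_eq, smul_mul_assoc, Finset.sum_mul]
      congr 1
      refine Finset.sum_congr rfl fun m _ => ?_
      simp only [ascInv, descProd, one_mul, mul_one]
      rw [mul_assoc, mul_assoc, ((tY_succ_mul_gY le_rfl hn).pow_right _).eq]
    have h2 : Commute (eY d n 1) (bY d n) := by
      rw [eY_eq]
      refine Commute.smul_left (Commute.sum_left _ _ _ fun m _ => ?_) _
      exact ((tY_commute_bY le_rfl (by omega)).pow_left _).mul_left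
        ((tY_commute_bY (by omega) hn).pow_left _)
    have h3 := eY_commute_gY (d := d) (n := n) (i := 1) le_rfl hn
    have h4 := bY_gY_bY_gY (d := d) (n := n)
    have h5 : bk d n (1 + 1) = gY d n 1 * bY d n * gInv d n 1 := rfl
    have h6 : bY d n * (eY d n 1 * gY d n 1) * bY d n =
        bY d n * gY d n 1 * bY d n * eY d n 1 := by
      rw [h3.eq]; simp only [mul_assoc]; rw [h2.eq]
    have h7 : eY d n 1 * gY d n 1 * bY d n * bY d n =
        gY d n 1 * bY d n * eY d n 1 * bY d n := by
      rw [h3.eq, mul_assoc (gY d n 1), h2.eq, ← mul_assoc]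
    rw [h1, h5, h6, h7, gInv]
    simp only [mul_sub, sub_mul, smul_sub, mul_smul_comm, smul_mul_assoc]
    simp only [← mul_assoc]
    rw [h4]
    abel
  | succ k hk ih =>
    have hc : Commute (gY d n (k + 1)) (bY d n) := (bY_commute_gY (by omega) hn).symm
    have hc' := gInv_commute (by omega) hn hc
    have h1 : crossTerm d n (k + 1) = gY d n (k + 1) * crossTerm d n k * gInv d n (k + 1) := by
      rw [crossTerm, crossTerm, mul_smul_comm, smul_mul_assoc, Finset.mul_sum, Finset.sum_mul]
      congr 1
      refine Finset.sum_congr rfl fun m _ => ?_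
      have hb := gInv_braid (d := d) hk hn
      have c1 : Commute (gY d n (k + 1)) (tY d n 1 ^ m) :=
        gY_commute_strandAlg hn (pow_mem (tY_mem le_rfl hk) _)
      have c2 : Commute (gInv d n (k + 1)) (tY d n 1 ^ (d - m)) :=
        gInv_commute (by omega) hn (gY_commute_strandAlg hn (pow_mem (tY_mem le_rfl hk) _))
      have c3 : Commute (gY d n (k + 1)) (ascInv d n k) :=
        gY_commute_strandAlg hn (ascInv_mem hk)
      have c4 : Commute (gInv d n (k + 1)) (descProd d n k) :=
        gInv_commute (by omega) hn (gY_commute_strandAlg hn (descProd_mem hk))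
      rw [ascInv_succ hk, descProd_succ hk]
      symm
      calc gY d n (k + 1) * (tY d n 1 ^ m * (ascInv d n k * gY d n k * descProd d n k) *
              tY d n 1 ^ (d - m)) * gInv d n (k + 1)
          = (gY d n (k + 1) * tY d n 1 ^ m) * ascInv d n k * gY d n k * descProd d n k *
              (tY d n 1 ^ (d - m) * gInv d n (k + 1)) := by simp only [mul_assoc]
        _ = tY d n 1 ^ m * (gY d n (k + 1) * ascInv d n k) * gY d n k * (descProd d n k *
              gInv d n (k + 1)) * tY d n 1 ^ (d - m) := by
            rw [c1.eq, ← c2.eq]; simp only [mul_assoc]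
        _ = tY d n 1 ^ m * ascInv d n k * (gY d n (k + 1) * gY d n k * gInv d n (k + 1)) *
              descProd d n k * tY d n 1 ^ (d - m) := by
            rw [c3.eq, ← c4.eq]; simp only [mul_assoc]
        _ = _ := by rw [hb]; simp only [mul_assoc]
    have ih' := congrArg (fun x => gY d n (k + 1) * x * gInv d n (k + 1)) (ih (by omega))
    have e : ∀ x : YB d n, gY d n (k + 1) * (x * bY d n) * gInv d n (k + 1) =
        gY d n (k + 1) * x * gInv d n (k + 1) * bY d n := fun x => by
      simp only [mul_assoc]; rw [hc'.eq]
    have e' : ∀ x : YB d n, gY d n (k + 1) * (bY d n * x) * gInv d n (k + 1) =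
        bY d n * (gY d n (k + 1) * x * gInv d n (k + 1)) := fun x => by
      rw [← mul_assoc, hc.eq]; simp only [mul_assoc]
    simp only [mul_add, mul_sub, add_mul, sub_mul, mul_smul_comm, smul_mul_assoc, e, e'] at ih'
    rw [bk_succ (by omega), h1, ih', mul_assoc (bY d n)]

end StrandAlg

/-- The left `strandAlg d n k`-module spanned by the products of an element on `k` strands with
`t_{k+1}^a`, `t_{k+1}^a b_{k+1}`, and `g_k s'` with `s'` on `k` strands. -/
def strandSpan (d n k : ℕ) : Submodule Kf (YB d n) := Submodule.span Kf
  {x | (∃ s ∈ strandAlg d n k, ∃ a : ℕ, x = s * tY d n (k + 1) ^ a) ∨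
    (∃ s ∈ strandAlg d n k, ∃ a : ℕ, x = s * (tY d n (k + 1) ^ a * bk d n (k + 1))) ∨
    (1 ≤ k ∧ ∃ s ∈ strandAlg d n k, ∃ s' ∈ strandAlg d n k, x = s * gY d n k * s')}

section Span

variable {d n k : ℕ}

theorem mul_tY_pow_mem {s : YB d n} (hs : s ∈ strandAlg d n k) (a : ℕ) :
    s * tY d n (k + 1) ^ a ∈ strandSpan d n k :=
  Submodule.subset_span (Or.inl ⟨s, hs, a, rfl⟩)

theorem mul_tY_pow_mul_bk_mem {s : YB d n} (hs : s ∈ strandAlg d n k) (a : ℕ) :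
    s * (tY d n (k + 1) ^ a * bk d n (k + 1)) ∈ strandSpan d n k :=
  Submodule.subset_span (Or.inr (Or.inl ⟨s, hs, a, rfl⟩))

theorem mul_gY_mul_mem (hk : 1 ≤ k) {s s' : YB d n} (hs : s ∈ strandAlg d n k)
    (hs' : s' ∈ strandAlg d n k) : s * gY d n k * s' ∈ strandSpan d n k :=
  Submodule.subset_span (Or.inr (Or.inr ⟨hk, s, hs, s', hs', rfl⟩))

theorem strandSpan_le {P : Submodule Kf (YB d n)}
    (h1 : ∀ s ∈ strandAlg d n k, ∀ a : ℕ, s * tY d n (k + 1) ^ a ∈ P)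
    (h2 : ∀ s ∈ strandAlg d n k, ∀ a : ℕ, s * (tY d n (k + 1) ^ a * bk d n (k + 1)) ∈ P)
    (h3 : 1 ≤ k → ∀ s ∈ strandAlg d n k, ∀ s' ∈ strandAlg d n k, s * gY d n k * s' ∈ P) :
    strandSpan d n k ≤ P := by
  refine Submodule.span_le.2 ?_
  rintro x (⟨s, hs, a, rfl⟩ | ⟨s, hs, a, rfl⟩ | ⟨hk, s, hs, s', hs', rfl⟩)
  · exact h1 s hs a
  · exact h2 s hs a
  · exact h3 hk s hs s' hs'

theorem mul_mem_strandSpan {s x : YB d n} (hs : s ∈ strandAlg d n k)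
    (hx : x ∈ strandSpan d n k) : s * x ∈ strandSpan d n k := by
  suffices h : strandSpan d n k ≤ (strandSpan d n k).comap (LinearMap.mulLeft Kf s) from h hx
  refine strandSpan_le (fun r hr a => ?_) (fun r hr a => ?_) (fun hk r hr r' hr' => ?_)
  · simpa [mul_assoc] using mul_tY_pow_mem (mul_mem hs hr) a
  · simpa [mul_assoc] using mul_tY_pow_mul_bk_mem (mul_mem hs hr) a
  · simpa [mul_assoc] using mul_gY_mul_mem hk (mul_mem hs hr) hr'

theorem tY_pow_mul_gY (hk : 1 ≤ k) (hn : k + 1 ≤ n) {s : YB d n} (hs : s ∈ strandAlg d n k)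
    (a : ℕ) (s' : YB d n) :
    tY d n (k + 1) ^ a * (s * gY d n k * s') = s * gY d n k * (tY d n k ^ a * s') := by
  have c := ((tY_commute_strandAlg hn hs).pow_left a).eq
  have c' := ((tY_succ_mul_gY (d := d) hk hn).pow_right a).eq
  rw [mul_assoc, ← mul_assoc, c, mul_assoc, ← mul_assoc (_ ^ a), ← c']
  simp only [mul_assoc]

theorem tY_pow_mul_mem_strandSpan (hn : k + 1 ≤ n) {x : YB d n} (a : ℕ)
    (hx : x ∈ strandSpan d n k) : tY d n (k + 1) ^ a * x ∈ strandSpan d n k := by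
  suffices h : strandSpan d n k ≤
      (strandSpan d n k).comap (LinearMap.mulLeft Kf (tY d n (k + 1) ^ a)) from h hx
  refine strandSpan_le (fun r hr m => ?_) (fun r hr m => ?_) (fun hk r hr r' hr' => ?_)
  · have c := ((tY_commute_strandAlg hn hr).pow_left a).eq
    have h := mul_tY_pow_mem hr (a + m)
    rw [pow_add, ← mul_assoc, ← c, mul_assoc] at h
    exact h
  · have c := ((tY_commute_strandAlg hn hr).pow_left a).eq
    have h := mul_tY_pow_mul_bk_mem hr (a + m)
    rw [pow_add, mul_assoc, ← mul_assoc, ← c, mul_assoc] at h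
    exact h
  · have h := mul_gY_mul_mem hk hr (mul_mem (pow_mem (tY_mem hk le_rfl) a) hr')
    rwa [← tY_pow_mul_gY hk hn hr] at h

theorem strandSpan_mul_tY_pow (hn : k + 1 ≤ n) {x : YB d n} (a : ℕ)
    (hx : x ∈ strandSpan d n k) : x * tY d n (k + 1) ^ a ∈ strandSpan d n k := by
  suffices h : strandSpan d n k ≤
      (strandSpan d n k).comap (LinearMap.mulRight Kf (tY d n (k + 1) ^ a)) from h hx
  refine strandSpan_le (fun r hr m => ?_) (fun r hr m => ?_) (fun hk r hr r' hr' => ?_)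
  · have h := mul_tY_pow_mem hr (m + a)
    rw [pow_add, ← mul_assoc] at h
    exact h
  · have c := ((tY_commute_bk (d := d) (j := k + 1) (k := k + 1) (by omega) hn
      (by omega) hn).pow_left a).eq
    have h := mul_tY_pow_mul_bk_mem hr (m + a)
    rw [pow_add, mul_assoc, c, ← mul_assoc (_ ^ m), ← mul_assoc r] at h
    exact h
  · have c := ((tY_commute_strandAlg hn hr').pow_left a).eq
    have c' := ((tY_mul_gY_self (d := d) hk hn).pow_right a).eq
    have h := mul_gY_mul_mem hk (mul_mem hr (pow_mem (tY_mem hk le_rfl) a)) hr'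
    rw [mul_assoc r, ← c', ← mul_assoc r, mul_assoc, c, ← mul_assoc] at h
    exact h

theorem crossTerm_mem (hk : 1 ≤ k) : crossTerm d n k ∈ Submodule.span Kf
    {x | ∃ s ∈ strandAlg d n k, ∃ s' ∈ strandAlg d n k, x = s * gY d n k * s'} := by
  refine Submodule.smul_mem _ _ (Submodule.sum_mem _ fun m _ => Submodule.subset_span ?_)
  refine ⟨tY d n 1 ^ m * ascInv d n k, mul_mem (pow_mem (tY_mem le_rfl hk) _) (ascInv_mem hk),
    descProd d n k * tY d n 1 ^ (d - m),
    mul_mem (descProd_mem hk) (pow_mem (tY_mem le_rfl hk) _), ?_⟩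
  simp only [mul_assoc]

theorem mul_crossTerm_mul_mem (hk : 1 ≤ k) {s s' : YB d n} (hs : s ∈ strandAlg d n k)
    (hs' : s' ∈ strandAlg d n k) : s * crossTerm d n k * s' ∈ strandSpan d n k := by
  suffices h : Submodule.span Kf
      {x | ∃ s ∈ strandAlg d n k, ∃ s' ∈ strandAlg d n k, x = s * gY d n k * s'} ≤
      (strandSpan d n k).comap (LinearMap.mulRight Kf s' ∘ₗ LinearMap.mulLeft Kf s) from
    h (crossTerm_mem hk)
  refine Submodule.span_le.2 ?_
  rintro x ⟨r, hr, r', hr', rfl⟩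
  simpa [mul_assoc] using mul_gY_mul_mem hk (mul_mem hs hr) (mul_mem hr' hs')

theorem bk_mul_bY_mem (hk : 1 ≤ k) (hn : k + 1 ≤ n) :
    bk d n (k + 1) * bY d n ∈ strandSpan d n k := by
  have hb := bY_mem (d := d) (n := n) hk
  have h := mul_tY_pow_mul_bk_mem hb 0
  rw [pow_zero, one_mul] at h
  rw [bk_mul_bY hk hn]
  refine Submodule.add_mem _ h (Submodule.smul_mem _ _ (Submodule.sub_mem _
    (mul_crossTerm_mul_mem hk hb hb) ?_))
  simpa [mul_assoc] using mul_crossTerm_mul_mem hk (one_mem _) (mul_mem hb hb)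

theorem mul_tY_pow_mul_mem {s x : YB d n} (hn : k + 1 ≤ n) (hs : s ∈ strandAlg d n k) (a : ℕ)
    (hx : x ∈ strandSpan d n k) : s * tY d n (k + 1) ^ a * x ∈ strandSpan d n k := by
  rw [mul_assoc]
  exact mul_mem_strandSpan hs (tY_pow_mul_mem_strandSpan hn a hx)

theorem bk_mul_mem_strandSpan (hk : 1 ≤ k) (hn : k + 1 ≤ n) {h : YB d n}
    (hh : h ∈ strandGens d n k) : bk d n (k + 1) * h ∈ strandSpan d n k := by
  have aux : ∀ s ∈ strandAlg d n k, Commute (bk d n (k + 1)) s →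
      bk d n (k + 1) * s ∈ strandSpan d n k := fun s hs hc => by
    have := mul_tY_pow_mul_bk_mem hs 0
    rwa [pow_zero, one_mul, ← hc.eq] at this
  rcases hh with ⟨_, rfl⟩ | ⟨i, h1, h2, rfl⟩ | ⟨j, h1, h2, rfl⟩
  · exact bk_mul_bY_mem hk hn
  · exact aux _ (gY_mem h1 h2) (bk_commute_gY h1 h2 hn)
  · exact aux _ (tY_mem h1 h2) (tY_commute_bk (by omega) hn h1 (by omega)).symm

theorem strandSpan_mul_gen (hk : 1 ≤ k) (hn : k + 1 ≤ n) {x h : YB d n}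
    (hx : x ∈ strandSpan d n k) (hh : h ∈ strandGens d n k) : x * h ∈ strandSpan d n k := by
  have hh' : h ∈ strandAlg d n k := Algebra.subset_adjoin hh
  suffices h : strandSpan d n k ≤ (strandSpan d n k).comap (LinearMap.mulRight Kf h) from h hx
  refine strandSpan_le (fun r hr a => ?_) (fun r hr a => ?_) (fun hk r hr r' hr' => ?_)
  · have c := ((tY_commute_strandAlg hn hh').pow_left a).eq
    have := mul_tY_pow_mem (mul_mem hr hh') a
    rw [mul_assoc, ← c, ← mul_assoc] at this
    exact this
  · have := mul_tY_pow_mul_mem hn hr a (bk_mul_mem_strandSpan hk hn hh)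
    simpa [mul_assoc] using this
  · simpa [mul_assoc] using mul_gY_mul_mem hk hr (mul_mem hr' hh')

theorem strandSpan_mul_strandAlg (hk : 1 ≤ k) (hn : k + 1 ≤ n) {x s : YB d n}
    (hx : x ∈ strandSpan d n k) (hs : s ∈ strandAlg d n k) : x * s ∈ strandSpan d n k := by
  induction hs using Algebra.adjoin_induction generalizing x with
  | mem h hh => exact strandSpan_mul_gen hk hn hx hh
  | algebraMap r =>
    rw [← Algebra.commutes, ← Algebra.smul_def]
    exact Submodule.smul_mem _ _ hx
  | add y z _ _ hy hz => rw [mul_add]; exact Submodule.add_mem _ (hy hx) (hz hx)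
  | mul y z _ _ hy hz => rw [← mul_assoc]; exact hz (hy hx)

theorem gY_mem_strandSpan (hk : 1 ≤ k) : gY d n k ∈ strandSpan d n k := by
  simpa using mul_gY_mul_mem (d := d) (n := n) hk (one_mem _) (one_mem _)

theorem one_mem_strandSpan : 1 ∈ strandSpan d n k := by
  simpa using mul_tY_pow_mem (d := d) (n := n) (k := k) (one_mem _) 0

theorem mul_eY_mem (hk : 1 ≤ k) (hn : k + 1 ≤ n) {x : YB d n} (hx : x ∈ strandSpan d n k) :
    x * eY d n k ∈ strandSpan d n k := by
  rw [eY_eq, mul_smul_comm, Finset.mul_sum]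
  refine Submodule.smul_mem _ _ (Submodule.sum_mem _ fun m _ => ?_)
  rw [← mul_assoc]
  exact strandSpan_mul_tY_pow hn _
    (strandSpan_mul_strandAlg hk hn hx (pow_mem (tY_mem hk le_rfl) _))

theorem gY_mul_gY_mem (hk : 1 ≤ k) (hn : k + 1 ≤ n) :
    gY d n k * gY d n k ∈ strandSpan d n k := by
  rw [gY_sq hk hn, (eY_commute_gY hk hn).eq]
  exact Submodule.add_mem _ one_mem_strandSpan
    (Submodule.smul_mem _ _ (mul_eY_mem hk hn (gY_mem_strandSpan hk)))

theorem gY_mul_bk_mul_gY (hk : 1 ≤ k) :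
    gY d n k * bk d n k * gY d n k = bk d n (k + 1) +
      (uu - uu⁻¹) • (gY d n k * bk d n k * eY d n k) := by
  rw [bk_succ hk, gInv, mul_sub, mul_smul_comm, sub_add_cancel]

theorem gY_mul_bk_mul_gY_mem (hk : 1 ≤ k) (hn : k + 1 ≤ n) :
    gY d n k * bk d n k * gY d n k ∈ strandSpan d n k := by
  rw [gY_mul_bk_mul_gY hk]
  have h1 := mul_tY_pow_mul_bk_mem (d := d) (n := n) (k := k) (one_mem _) 0
  rw [pow_zero, one_mul, one_mul] at h1
  exact Submodule.add_mem _ h1 (Submodule.smul_mem _ _ (mul_eY_mem hk hn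
    (strandSpan_mul_strandAlg hk hn (gY_mem_strandSpan hk) (bk_mem hk))))

theorem gY_mul_mul_gY_mem (hn : k + 2 ≤ n) {s : YB d n} (hs : s ∈ strandSpan d n k) :
    gY d n (k + 1) * s * gY d n (k + 1) ∈ strandSpan d n (k + 1) := by
  suffices h : strandSpan d n k ≤ (strandSpan d n (k + 1)).comap
      (LinearMap.mulRight Kf (gY d n (k + 1)) ∘ₗ LinearMap.mulLeft Kf (gY d n (k + 1))) from h hs
  have key : ∀ v ∈ strandAlg d n k, ∀ a : ℕ, ∀ x : YB d n,
      gY d n (k + 1) * x ∈ strandSpan d n (k + 1) →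
      gY d n (k + 1) * (v * (tY d n (k + 1) ^ a * x)) ∈ strandSpan d n (k + 1) := by
    intro v hv a x hx
    have c := (gY_commute_strandAlg hn hv).eq
    have c' := ((tY_succ_mul_gY (d := d) (n := n) (i := k + 1) (by omega) hn).pow_right a).eq
    rw [← mul_assoc, c, mul_assoc, ← mul_assoc (gY d n (k + 1)), c', mul_assoc]
    exact mul_mem_strandSpan (strandAlg_mono (by omega) hv)
      (tY_pow_mul_mem_strandSpan hn a hx)
  refine strandSpan_le (fun r hr a => ?_) (fun r hr a => ?_) (fun hk r hr r' hr' => ?_)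
  · simpa [mul_assoc] using key r hr a _ (gY_mul_gY_mem (by omega) hn)
  · have h := gY_mul_bk_mul_gY_mem (d := d) (n := n) (k := k + 1) (by omega) hn
    rw [mul_assoc] at h
    simpa [mul_assoc] using key r hr a _ h
  · have c := (gY_commute_strandAlg hn hr).eq
    have c' := (gY_commute_strandAlg hn hr').eq
    have hb := gY_braid (d := d) hk hn
    have e : gY d n (k + 1) * (r * gY d n k * r') * gY d n (k + 1) =
        r * gY d n k * gY d n (k + 1) * (gY d n k * r') := by
      calc gY d n (k + 1) * (r * gY d n k * r') * gY d n (k + 1)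
          = (gY d n (k + 1) * r) * gY d n k * (r' * gY d n (k + 1)) := by simp only [mul_assoc]
        _ = r * (gY d n (k + 1) * gY d n k * gY d n (k + 1)) * r' := by
            rw [c, ← c']; simp only [mul_assoc]
        _ = _ := by rw [← hb]; simp only [mul_assoc]
    have hr1 := strandAlg_mono (show k ≤ k + 1 by omega) hr
    have hr2 := strandAlg_mono (show k ≤ k + 1 by omega) hr'
    have hg := gY_mem (d := d) (n := n) (k := k + 1) hk (by omega)
    have := mul_gY_mul_mem (by omega) (mul_mem hr1 hg) (mul_mem hg hr2)
    rw [← e] at this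
    exact this

theorem strandSpan_mul_gY (hn : k + 2 ≤ n)
    (ih : ∀ s ∈ strandAlg d n (k + 1), s ∈ strandSpan d n k) {x : YB d n}
    (hx : x ∈ strandSpan d n (k + 1)) : x * gY d n (k + 1) ∈ strandSpan d n (k + 1) := by
  suffices h : strandSpan d n (k + 1) ≤
      (strandSpan d n (k + 1)).comap (LinearMap.mulRight Kf (gY d n (k + 1))) from h hx
  have hk : 1 ≤ k + 1 := by omega
  refine strandSpan_le (fun r hr a => ?_) (fun r hr a => ?_) (fun _ r hr r' hr' => ?_)
  · exact mul_tY_pow_mul_mem hn hr a (gY_mem_strandSpan hk)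
  · have h : bk d n (k + 1 + 1) * gY d n (k + 1) ∈ strandSpan d n (k + 1) := by
      rw [bk_succ hk, mul_assoc, gInv_mul_gY hk hn, mul_one]
      exact strandSpan_mul_strandAlg hk hn (gY_mem_strandSpan hk) (bk_mem hk)
    simpa [mul_assoc] using mul_tY_pow_mul_mem hn hr a h
  · simpa [mul_assoc] using mul_mem_strandSpan hr (gY_mul_mul_gY_mem hn (ih r' hr'))

theorem strandAlg_le_of_mul_mem {N : Submodule Kf (YB d n)} (h1 : 1 ∈ N)
    (hN : ∀ h ∈ strandGens d n k, ∀ x ∈ N, x * h ∈ N) {s : YB d n}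
    (hs : s ∈ strandAlg d n k) : s ∈ N := by
  suffices h : ∀ x ∈ N, x * s ∈ N by simpa using h 1 h1
  induction hs using Algebra.adjoin_induction with
  | mem h hh => exact hN h hh
  | algebraMap r =>
    intro x hx
    rw [← Algebra.commutes, ← Algebra.smul_def]
    exact Submodule.smul_mem _ _ hx
  | add y z _ _ hy hz =>
    intro x hx
    rw [mul_add]
    exact Submodule.add_mem _ (hy x hx) (hz x hx)
  | mul y z _ _ hy hz =>
    intro x hx
    rw [← mul_assoc]
    exact hz _ (hy x hx)

theorem strandSpan_zero_mul_bY (hn : 1 ≤ n) {x : YB d n} (hx : x ∈ strandSpan d n 0) :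
    x * bY d n ∈ strandSpan d n 0 := by
  suffices h : strandSpan d n 0 ≤
      (strandSpan d n 0).comap (LinearMap.mulRight Kf (bY d n)) from h hx
  refine strandSpan_le (fun r hr a => ?_) (fun r hr a => ?_) (fun hk => absurd hk (by omega))
  · have := mul_tY_pow_mul_bk_mem hr a
    rw [← mul_assoc] at this
    exact this
  · have h : bY d n * bY d n ∈ strandSpan d n 0 := by
      rw [bY_sq, smul_mul_assoc, Finset.sum_mul]
      refine Submodule.add_mem _ one_mem_strandSpan (Submodule.smul_mem _ _
        (Submodule.smul_mem _ _ (Submodule.sum_mem _ fun m _ => ?_)))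
      simpa [bk] using mul_tY_pow_mul_bk_mem (d := d) (n := n) (k := 0) (one_mem _) m
    have hm := mul_tY_pow_mul_mem hn hr a h
    simpa [mul_assoc, bk] using hm

/-- The algebra on `k + 1` strands is spanned by the products defining `strandSpan`. -/
theorem strandAlg_succ_le (hn : k + 1 ≤ n) {s : YB d n} (hs : s ∈ strandAlg d n (k + 1)) :
    s ∈ strandSpan d n k := by
  induction k generalizing s with
  | zero =>
    refine strandAlg_le_of_mul_mem one_mem_strandSpan ?_ hs
    rintro h (⟨_, rfl⟩ | ⟨i, h1, h2, rfl⟩ | ⟨j, h1, h2, rfl⟩) x hx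
    · exact strandSpan_zero_mul_bY hn hx
    · omega
    · obtain rfl : j = 0 + 1 := by omega
      simpa using strandSpan_mul_tY_pow hn 1 hx
  | succ k ih =>
    refine strandAlg_le_of_mul_mem one_mem_strandSpan ?_ hs
    have hk : 1 ≤ k + 1 := by omega
    rintro h (⟨_, rfl⟩ | ⟨i, h1, h2, rfl⟩ | ⟨j, h1, h2, rfl⟩) x hx
    · exact strandSpan_mul_strandAlg hk hn hx (bY_mem hk)
    · rcases eq_or_ne i (k + 1) with rfl | hi
      · exact strandSpan_mul_gY hn (fun s => ih (by omega)) hx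
      · exact strandSpan_mul_strandAlg hk hn hx (gY_mem h1 (by omega))
    · rcases eq_or_ne j (k + 2) with rfl | hj
      · simpa using strandSpan_mul_tY_pow hn 1 hx
      · exact strandSpan_mul_strandAlg hk hn hx (tY_mem h1 (by omega))

end Span

/-- The products `𝔪_1 ⋯ 𝔪_k` with `𝔪_i ∈ M_{d,i}`, so that `Cset d n = prodSet d n n`. -/
def prodSet (d n k : ℕ) : Set (YB d n) :=
  {x | ∃ f : Fin k → YB d n, (∀ i : Fin k, f i ∈ Mset d n (i.val + 1)) ∧
    x = (List.ofFn f).prod}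

section ProdSet

variable {d n k : ℕ}

theorem mul_mem_prodSet {x m : YB d n} (hx : x ∈ prodSet d n k) (hm : m ∈ Mset d n (k + 1)) :
    x * m ∈ prodSet d n (k + 1) := by
  obtain ⟨f, hf, rfl⟩ := hx
  refine ⟨Fin.snoc f m, fun i => ?_, ?_⟩
  · induction i using Fin.lastCases with
    | last => simpa using hm
    | cast i => simpa using hf i
  · rw [List.ofFn_succ']
    simp only [List.concat_eq_append, List.prod_append, List.prod_singleton, Fin.snoc_castSucc,
      Fin.snoc_last]

theorem exists_of_mem_prodSet_succ {x : YB d n} (hx : x ∈ prodSet d n (k + 1)) :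
    ∃ v ∈ prodSet d n k, ∃ m ∈ Mset d n (k + 1), x = v * m := by
  obtain ⟨f, hf, rfl⟩ := hx
  refine ⟨_, ⟨fun i => f i.castSucc, fun i => hf i.castSucc, rfl⟩, f (Fin.last k),
    hf (Fin.last k), ?_⟩
  rw [List.ofFn_succ', List.concat_eq_append, List.prod_append, List.prod_singleton]

theorem Mset_subset_strandAlg {m : YB d n} (hm : m ∈ Mset d n (k + 1)) :
    m ∈ strandAlg d n (k + 1) := by
  induction k generalizing m with
  | zero =>
    obtain ⟨a, _, rfl | rfl⟩ := hm
    · exact pow_mem (tY_mem le_rfl le_rfl) _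
    · exact mul_mem (pow_mem (tY_mem le_rfl le_rfl) _) (bY_mem le_rfl)
  | succ k ih =>
    obtain ⟨a, _, rfl | rfl⟩ | ⟨y, hy, rfl⟩ := hm
    · exact pow_mem (tY_mem (by omega) le_rfl) _
    · exact mul_mem (pow_mem (tY_mem (by omega) le_rfl) _) (bk_mem (by omega))
    · exact mul_mem (gY_mem (by omega) (by omega)) (strandAlg_mono (by omega) (ih hy))

theorem prodSet_subset_strandAlg {x : YB d n} (hx : x ∈ prodSet d n k) :
    x ∈ strandAlg d n k := by
  induction k generalizing x with
  | zero =>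
    obtain ⟨f, _, rfl⟩ := hx
    simp
  | succ k ih =>
    obtain ⟨v, hv, m, hm, rfl⟩ := exists_of_mem_prodSet_succ hx
    exact mul_mem (strandAlg_mono (by omega) (ih hv)) (Mset_subset_strandAlg hm)

theorem tY_pow_mod (hk : 1 ≤ k) (hn : k ≤ n) (a : ℕ) : tY d n k ^ (a % d) = tY d n k ^ a :=
  (pow_eq_pow_mod a (tY_pow_d hk hn)).symm

theorem mod_le_pred (hd : 1 ≤ d) (a : ℕ) : a % d ≤ d - 1 := by
  have := Nat.mod_lt a hd
  omega

theorem tY_pow_mem_Mset (hd : 1 ≤ d) (hn : k + 1 ≤ n) (a : ℕ) :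
    tY d n (k + 1) ^ a ∈ Mset d n (k + 1) := by
  rw [← tY_pow_mod (by omega) hn]
  cases k with
  | zero => exact ⟨_, mod_le_pred hd a, Or.inl rfl⟩
  | succ k => exact Or.inl ⟨_, mod_le_pred hd a, Or.inl rfl⟩

theorem tY_pow_mul_bk_mem_Mset (hd : 1 ≤ d) (hn : k + 1 ≤ n) (a : ℕ) :
    tY d n (k + 1) ^ a * bk d n (k + 1) ∈ Mset d n (k + 1) := by
  rw [← tY_pow_mod (by omega) hn]
  cases k with
  | zero => exact ⟨_, mod_le_pred hd a, Or.inr rfl⟩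
  | succ k => exact Or.inl ⟨_, mod_le_pred hd a, Or.inr rfl⟩

theorem mul_mem_span_prodSet {s m : YB d n} (hs : s ∈ Submodule.span Kf (prodSet d n k))
    (hm : m ∈ Mset d n (k + 1)) : s * m ∈ Submodule.span Kf (prodSet d n (k + 1)) := by
  suffices h : Submodule.span Kf (prodSet d n k) ≤
      (Submodule.span Kf (prodSet d n (k + 1))).comap (LinearMap.mulRight Kf m) from h hs
  exact Submodule.span_le.2 fun x hx => Submodule.subset_span (mul_mem_prodSet hx hm)

theorem strandAlg_le_span_prodSet (hd : 1 ≤ d) (hn : k ≤ n) {s : YB d n}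
    (hs : s ∈ strandAlg d n k) : s ∈ Submodule.span Kf (prodSet d n k) := by
  induction k generalizing s with
  | zero =>
    have h1 : (1 : YB d n) ∈ Submodule.span Kf (prodSet d n 0) :=
      Submodule.subset_span ⟨fun _ => 1, fun i => i.elim0, by simp⟩
    refine strandAlg_le_of_mul_mem h1 ?_ hs
    rintro h (⟨h1, rfl⟩ | ⟨i, h1, h2, rfl⟩ | ⟨j, h1, h2, rfl⟩) <;> omega
  | succ k ih =>
    have ih' := fun {s} => ih (s := s) (by omega)
    refine strandSpan_le ?_ ?_ ?_ (strandAlg_succ_le hn hs)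
    · exact fun r hr a => mul_mem_span_prodSet (ih' hr) (tY_pow_mem_Mset hd hn a)
    · exact fun r hr a => mul_mem_span_prodSet (ih' hr) (tY_pow_mul_bk_mem_Mset hd hn a)
    · intro hk r hr r' hr'
      obtain ⟨k, rfl⟩ := Nat.exists_eq_add_of_le' hk
      suffices h : Submodule.span Kf (prodSet d n (k + 1)) ≤
          (Submodule.span Kf (prodSet d n (k + 2))).comap
            (LinearMap.mulLeft Kf (r * gY d n (k + 1))) from h (ih' hr')
      refine Submodule.span_le.2 fun x hx => ?_
      obtain ⟨v, hv, m, hm, rfl⟩ := exists_of_mem_prodSet_succ hx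
      have hv' := prodSet_subset_strandAlg hv
      have c := (gY_commute_strandAlg hn hv').eq
      have h := mul_mem_span_prodSet (ih' (mul_mem hr (strandAlg_mono (by omega) hv')))
        (show gY d n (k + 1) * m ∈ Mset d n (k + 2) from Or.inr ⟨m, hm, rfl⟩)
      rw [mul_assoc, ← mul_assoc v, ← c, mul_assoc, ← mul_assoc] at h
      exact h

theorem gRange_self : gRange d n k k = 1 := by simp [gRange]

theorem gRange_succ {j : ℕ} (hj : j ≤ k) :
    gRange d n j (k + 1) = gY d n k * gRange d n j k := by
  simp [gRange, show k + 1 - j = (k - j) + 1 by omega, List.range'_concat,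
    show j + (k - j) = k by omega]

theorem gY_mul_mPlus {j : ℕ} (hj : j ≤ k) (a : ℕ) :
    gY d n k * mPlus d n k j a = mPlus d n (k + 1) j a := by
  rw [mPlus, mPlus, if_neg (show j ≠ k + 1 by omega), gRange_succ hj]
  split_ifs with h
  · rw [h, gRange_self, mul_one]
  · rw [mul_assoc]

theorem gY_mul_mMinus {j : ℕ} (hk : 1 ≤ k) (hn : k ≤ n) (hj : j ≤ k) (a : ℕ) :
    gY d n k * mMinus d n k j a = mMinus d n (k + 1) j a := by
  rw [mMinus, mMinus, if_neg (show j ≠ k + 1 by omega), gRange_succ hj]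
  split_ifs with h
  · rw [h, gRange_self, mul_one, ((tY_commute_bk hk hn hk hn).pow_left a).eq]
  · rw [mul_assoc]

theorem exists_of_mem_Mset (hn : k + 1 ≤ n) {m : YB d n} (hm : m ∈ Mset d n (k + 1)) :
    ∃ j a, 1 ≤ j ∧ j ≤ k + 1 ∧ a ≤ d - 1 ∧
      (m = mPlus d n (k + 1) j a ∨ m = mMinus d n (k + 1) j a) := by
  induction k generalizing m with
  | zero =>
    obtain ⟨a, ha, h⟩ := hm
    exact ⟨1, a, le_rfl, le_rfl, ha, by simpa [mPlus, mMinus, bk] using h⟩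
  | succ k ih =>
    obtain ⟨a, ha, h⟩ | ⟨y, hy, rfl⟩ := hm
    · exact ⟨k + 2, a, by omega, le_rfl, ha, by simpa [mPlus, mMinus] using h⟩
    · obtain ⟨j, a, hj, hj', ha, rfl | rfl⟩ := ih (by omega) hy
      · exact ⟨j, a, hj, by omega, ha, Or.inl (gY_mul_mPlus hj' a)⟩
      · exact ⟨j, a, hj, by omega, ha, Or.inr (gY_mul_mMinus (by omega) (by omega) hj' a)⟩

theorem strandAlg_self (hn : 1 ≤ n) : strandAlg d n n = ⊤ := by
  have h1 : (mkY d n).range = ⊤ :=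
    (AlgHom.range_eq_top _).2 (RingQuot.mkAlgHom_surjective Kf (YBrel d n))
  rw [← h1, ← Algebra.map_top, ← FreeAlgebra.adjoin_range_ι, AlgHom.map_adjoin, strandAlg]
  refine le_antisymm (Algebra.adjoin_le ?_) (Algebra.adjoin_mono ?_)
  · rintro x (⟨_, rfl⟩ | ⟨i, h1, h2, rfl⟩ | ⟨j, h1, h2, rfl⟩)
    · exact Algebra.subset_adjoin ⟨_, ⟨Gen.b, rfl⟩, rfl⟩
    · refine Algebra.subset_adjoin ⟨_, ⟨Gen.g ⟨i - 1, by omega⟩, rfl⟩, ?_⟩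
      rw [gY, Gg, dif_pos ⟨h1, by omega⟩]
    · refine Algebra.subset_adjoin ⟨_, ⟨Gen.t ⟨j - 1, by omega⟩, rfl⟩, ?_⟩
      rw [tY, Tt, dif_pos ⟨h1, by omega⟩]
  · rintro _ ⟨_, ⟨g, rfl⟩, rfl⟩
    rcases g with _ | ⟨i, hi⟩ | ⟨j, hj⟩
    · exact Or.inl ⟨hn, rfl⟩
    · refine Or.inr (Or.inl ⟨i + 1, by omega, by omega, ?_⟩)
      rw [gY, Gg, dif_pos ⟨by omega, by omega⟩]
      rfl
    · refine Or.inr (Or.inr ⟨j + 1, by omega, by omega, ?_⟩)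
      rw [tY, Tt, dif_pos ⟨by omega, by omega⟩]
      rfl

end ProdSet

section Inclusion

variable {d p : ℕ} {inc : YB d p →ₐ[Kf] YB d (p + 1)}

theorem IsIncl.image_strandGens (h : IsIncl d p inc) {k : ℕ} (hk : k ≤ p) :
    inc '' strandGens d p k = strandGens d (p + 1) k := by
  ext x
  constructor
  · rintro ⟨_, ⟨h1, rfl⟩ | ⟨i, h1, h2, rfl⟩ | ⟨j, h1, h2, rfl⟩, rfl⟩
    · exact Or.inl ⟨h1, h.1⟩
    · exact Or.inr (Or.inl ⟨i, h1, h2, h.2.1 i h1 (by omega)⟩)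
    · exact Or.inr (Or.inr ⟨j, h1, h2, h.2.2 j h1 (by omega)⟩)
  · rintro (⟨h1, rfl⟩ | ⟨i, h1, h2, rfl⟩ | ⟨j, h1, h2, rfl⟩)
    · exact ⟨_, Or.inl ⟨h1, rfl⟩, h.1⟩
    · exact ⟨_, Or.inr (Or.inl ⟨i, h1, h2, rfl⟩), h.2.1 i h1 (by omega)⟩
    · exact ⟨_, Or.inr (Or.inr ⟨j, h1, h2, rfl⟩), h.2.2 j h1 (by omega)⟩

theorem IsIncl.map_strandAlg (h : IsIncl d p inc) {k : ℕ} (hk : k ≤ p) :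
    (strandAlg d p k).map inc = strandAlg d (p + 1) k := by
  rw [strandAlg, AlgHom.map_adjoin, h.image_strandGens hk, strandAlg]

theorem IsIncl.map_mem (h : IsIncl d p inc) {k : ℕ} (hk : k ≤ p) {s : YB d p}
    (hs : s ∈ strandAlg d p k) : inc s ∈ strandAlg d (p + 1) k := by
  rw [← h.map_strandAlg hk]
  exact Subalgebra.mem_map.2 ⟨s, hs, rfl⟩

theorem IsIncl.apply_mem (h : IsIncl d p inc) (hp : 1 ≤ p) (s : YB d p) :
    inc s ∈ strandAlg d (p + 1) p :=
  h.map_mem le_rfl (by rw [strandAlg_self hp]; exact Algebra.mem_top)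

theorem IsIncl.exists_of_mem (h : IsIncl d p inc) {s : YB d (p + 1)}
    (hs : s ∈ strandAlg d (p + 1) p) : ∃ w, inc w = s := by
  rw [← h.map_strandAlg le_rfl] at hs
  obtain ⟨w, _, hw⟩ := Subalgebra.mem_map.1 hs
  exact ⟨w, hw⟩

theorem IsIncl.map_gInv (h : IsIncl d p inc) {i : ℕ} (hi : 1 ≤ i) (hi' : i + 1 ≤ p) :
    inc (gInv d p i) = gInv d (p + 1) i := by
  simp only [gInv, eY_eq, map_sub, map_smul, map_sum, map_mul, map_pow,
    h.2.1 i hi (by omega), h.2.2 i hi (by omega), h.2.2 (i + 1) (by omega) hi']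

theorem IsIncl.map_bk (h : IsIncl d p inc) {k : ℕ} (hk : 1 ≤ k) (hk' : k ≤ p) :
    inc (bk d p k) = bk d (p + 1) k := by
  induction k, hk using Nat.le_induction with
  | base => exact h.1
  | succ k hk ih =>
    rw [bk_succ hk, bk_succ hk, map_mul, map_mul, h.map_gInv hk hk', ih (by omega),
      h.2.1 k hk (by omega)]

theorem IsIncl.map_ascInv (h : IsIncl d p inc) {k : ℕ} (hk : 1 ≤ k) (hk' : k ≤ p) :
    inc (ascInv d p k) = ascInv d (p + 1) k := by
  induction k, hk using Nat.le_induction with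
  | base => exact map_one inc
  | succ k hk ih =>
    rw [ascInv_succ hk, ascInv_succ hk, map_mul, h.map_gInv hk hk', ih (by omega)]

theorem IsIncl.map_descProd (h : IsIncl d p inc) {k : ℕ} (hk : 1 ≤ k) (hk' : k ≤ p) :
    inc (descProd d p k) = descProd d (p + 1) k := by
  induction k, hk using Nat.le_induction with
  | base => exact map_one inc
  | succ k hk ih =>
    rw [descProd_succ hk, descProd_succ hk, map_mul, h.2.1 k hk (by omega), ih (by omega)]

theorem IsIncl.map_gRange (h : IsIncl d p inc) {j k : ℕ} (hj : 1 ≤ j) (hjk : j ≤ k)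
    (hk : k ≤ p) : inc (gRange d p j k) = gRange d (p + 1) j k := by
  induction k, hjk using Nat.le_induction with
  | base => rw [gRange_self, gRange_self, map_one]
  | succ k hjk ih =>
    rw [gRange_succ hjk, gRange_succ hjk, map_mul, h.2.1 k (by omega) (by omega), ih (by omega)]

theorem IsIncl.map_mPlus (h : IsIncl d p inc) {j k : ℕ} (hj : 1 ≤ j) (hjk : j ≤ k)
    (hk : k ≤ p) (a : ℕ) : inc (mPlus d p k j a) = mPlus d (p + 1) k j a := by
  unfold mPlus
  split_ifs
  · rw [map_pow, h.2.2 k (by omega) hk]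
  · rw [map_mul, map_pow, h.map_gRange hj hjk hk, h.2.2 j hj (by omega)]

theorem IsIncl.map_mMinus (h : IsIncl d p inc) {j k : ℕ} (hj : 1 ≤ j) (hjk : j ≤ k)
    (hk : k ≤ p) (a : ℕ) : inc (mMinus d p k j a) = mMinus d (p + 1) k j a := by
  unfold mMinus
  split_ifs
  · rw [map_mul, map_pow, h.2.2 k (by omega) hk, h.map_bk (by omega) hk]
  · rw [map_mul, map_mul, map_pow, h.map_gRange hj hjk hk, h.2.2 j hj (by omega),
      h.map_bk hj (by omega)]

theorem mem_span_Cset (hd : 1 ≤ d) (hp : 1 ≤ p) (w : YB d p) :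
    w ∈ Submodule.span Kf (Cset d p) :=
  strandAlg_le_span_prodSet hd le_rfl (by rw [strandAlg_self hp]; exact Algebra.mem_top)

theorem linearMap_ext_Cset (hd : 1 ≤ d) (hp : 1 ≤ p) {M : Type*} [AddCommMonoid M] [Module Kf M]
    {f g : YB d p →ₗ[Kf] M} (h : ∀ w ∈ Cset d p, f w = g w) (w : YB d p) : f w = g w :=
  LinearMap.eqOn_span h (mem_span_Cset hd hp w)

theorem IsIncl.linearMap_ext (h : IsIncl d p inc) {M : Type*} [AddCommMonoid M] [Module Kf M]
    {f g : YB d (p + 1) →ₗ[Kf] M} (hp : 1 ≤ p)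
    (h1 : ∀ w a, f (inc w * tY d (p + 1) (p + 1) ^ a) = g (inc w * tY d (p + 1) (p + 1) ^ a))
    (h2 : ∀ w a, f (inc w * (tY d (p + 1) (p + 1) ^ a * bk d (p + 1) (p + 1))) =
      g (inc w * (tY d (p + 1) (p + 1) ^ a * bk d (p + 1) (p + 1))))
    (h3 : ∀ w w', f (inc w * gY d (p + 1) p * inc w') = g (inc w * gY d (p + 1) p * inc w'))
    (Y : YB d (p + 1)) : f Y = g Y := by
  have hY : Y ∈ strandSpan d (p + 1) p :=
    strandAlg_succ_le le_rfl (by rw [strandAlg_self (by omega)]; exact Algebra.mem_top)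
  refine strandSpan_le (P := LinearMap.eqLocus f g) ?_ ?_ ?_ hY
  · intro s hs a
    obtain ⟨w, rfl⟩ := h.exists_of_mem hs
    exact h1 w a
  · intro s hs a
    obtain ⟨w, rfl⟩ := h.exists_of_mem hs
    exact h2 w a
  · intro _ s hs s' hs'
    obtain ⟨w, rfl⟩ := h.exists_of_mem hs
    obtain ⟨w', rfl⟩ := h.exists_of_mem hs'
    exact h3 w w'

end Inclusion

section RelativeTrace

variable {d p : ℕ} {x y : ZMod d → Kf} {inc : YB d p →ₐ[Kf] YB d (p + 1)}
  {tr : YB d (p + 1) →ₗ[Kf] YB d p}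

theorem IsRelTrace.apply_tY_pow (htr : IsRelTrace d x y p inc tr) (hd : 1 ≤ d) (hp : 1 ≤ p)
    (w : YB d p) (a : ℕ) :
    tr (inc w * tY d (p + 1) (p + 1) ^ a) = x (a : ZMod d) • w := by
  rw [← tY_pow_mod (by omega) le_rfl a]
  refine linearMap_ext_Cset hd hp
    (f := tr ∘ₗ LinearMap.mulRight Kf (tY d (p + 1) (p + 1) ^ (a % d)) ∘ₗ inc.toLinearMap)
    (g := x (a : ZMod d) • LinearMap.id) (fun w hw => ?_) w
  simpa using (htr w hw _ (mod_le_pred hd a)).1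

theorem IsRelTrace.apply_tY_pow_mul_bk (htr : IsRelTrace d x y p inc tr) (hd : 1 ≤ d)
    (hp : 1 ≤ p) (w : YB d p) (a : ℕ) :
    tr (inc w * (tY d (p + 1) (p + 1) ^ a * bk d (p + 1) (p + 1))) = y (a : ZMod d) • w := by
  rw [← tY_pow_mod (by omega) le_rfl a,
    ((tY_commute_bk (by omega) le_rfl (by omega) le_rfl).pow_left _).eq]
  refine linearMap_ext_Cset hd hp
    (f := tr ∘ₗ LinearMap.mulRight Kf
      (bk d (p + 1) (p + 1) * tY d (p + 1) (p + 1) ^ (a % d)) ∘ₗ inc.toLinearMap)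
    (g := y (a : ZMod d) • LinearMap.id) (fun w hw => ?_) w
  simpa [mul_assoc] using (htr w hw _ (mod_le_pred hd a)).2.1

theorem IsRelTrace.apply_gY_mul_Mset (htr : IsRelTrace d x y p inc tr) (hinc : IsIncl d p inc)
    (hd : 1 ≤ d) (hp : 1 ≤ p) (w : YB d p) {m : YB d p} (hm : m ∈ Mset d p p) :
    tr (inc w * (gY d (p + 1) p * inc m)) = zz • (w * m) := by
  refine linearMap_ext_Cset hd hp
    (f := tr ∘ₗ LinearMap.mulRight Kf (gY d (p + 1) p * inc m) ∘ₗ inc.toLinearMap)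
    (g := zz • LinearMap.mulRight Kf m) (fun w hw => ?_) w
  obtain ⟨q, rfl⟩ := Nat.exists_eq_add_of_le' hp
  obtain ⟨j, a, hj, hj', ha, rfl | rfl⟩ := exists_of_mem_Mset le_rfl hm
  · have := ((htr w hw a ha).2.2 j hj hj').1
    rw [← gY_mul_mPlus hj', ← hinc.map_mPlus hj hj' le_rfl] at this
    simpa [mul_assoc] using this
  · have := ((htr w hw a ha).2.2 j hj hj').2
    rw [← gY_mul_mMinus hp (by omega) hj', ← hinc.map_mMinus hj hj' le_rfl] at this
    simpa [mul_assoc] using this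

theorem IsRelTrace.apply_mul_gY_mul (htr : IsRelTrace d x y p inc tr) (hinc : IsIncl d p inc)
    (hd : 1 ≤ d) (hp : 1 ≤ p) (w w' : YB d p) :
    tr (inc w * gY d (p + 1) p * inc w') = zz • (w * w') := by
  refine linearMap_ext_Cset hd hp
    (f := tr ∘ₗ LinearMap.mulLeft Kf (inc w * gY d (p + 1) p) ∘ₗ inc.toLinearMap)
    (g := zz • LinearMap.mulLeft Kf w) (fun w' hw' => ?_) w'
  obtain ⟨q, rfl⟩ := Nat.exists_eq_add_of_le' hp
  obtain ⟨v, hv, m, hm, rfl⟩ := exists_of_mem_prodSet_succ hw'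
  have c := (gY_commute_strandAlg le_rfl
    (hinc.map_mem (by omega) (prodSet_subset_strandAlg hv))).eq
  have h := htr.apply_gY_mul_Mset hinc hd hp (w * v) hm
  rw [map_mul inc, mul_assoc, ← mul_assoc (inc v), ← c] at h
  simpa [mul_assoc] using h

theorem IsRelTrace.map_mul_left (htr : IsRelTrace d x y p inc tr) (hinc : IsIncl d p inc)
    (hd : 1 ≤ d) (hp : 1 ≤ p) (X : YB d p) (Y : YB d (p + 1)) :
    tr (inc X * Y) = X * tr Y := by
  refine hinc.linearMap_ext (f := tr ∘ₗ LinearMap.mulLeft Kf (inc X))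
    (g := LinearMap.mulLeft Kf X ∘ₗ tr) hp (fun w a => ?_) (fun w a => ?_) (fun w w' => ?_) Y
  · simp only [LinearMap.comp_apply, LinearMap.mulLeft_apply, ← mul_assoc, ← map_mul,
      htr.apply_tY_pow hd hp, mul_smul_comm]
  · have h := htr.apply_tY_pow_mul_bk hd hp (X * w) a
    rw [map_mul inc, mul_assoc] at h
    simp only [LinearMap.comp_apply, LinearMap.mulLeft_apply, h,
      htr.apply_tY_pow_mul_bk hd hp, mul_smul_comm]
  · simp only [LinearMap.comp_apply, LinearMap.mulLeft_apply, ← mul_assoc, ← map_mul,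
      htr.apply_mul_gY_mul hinc hd hp, mul_smul_comm]

theorem IsRelTrace.apply_crossTerm (htr : IsRelTrace d x y p inc tr) (hinc : IsIncl d p inc)
    (hd : 1 ≤ d) (hp : 1 ≤ p) (r s : YB d p) (a : ℕ) :
    tr (inc r * (tY d (p + 1) (p + 1) ^ a * (crossTerm d (p + 1) p * inc s))) =
      zz • (r * ((d : Kf)⁻¹ • ∑ m ∈ Finset.range d,
        tY d p 1 ^ m * tY d p 1 ^ a * tY d p 1 ^ (d - m)) * s) := by
  simp only [crossTerm, mul_smul_comm, smul_mul_assoc, Finset.mul_sum, Finset.sum_mul, map_smul,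
    map_sum]
  rw [smul_comm zz]
  simp only [Finset.smul_sum]
  refine Finset.sum_congr rfl fun m _ => congrArg _ ?_
  have h1 : tY d (p + 1) 1 ^ m * (ascInv d (p + 1) p * gY d (p + 1) p * descProd d (p + 1) p) *
      tY d (p + 1) 1 ^ (d - m) * inc s = inc (tY d p 1 ^ m * ascInv d p p) * gY d (p + 1) p *
        inc (descProd d p p * tY d p 1 ^ (d - m) * s) := by
    simp only [map_mul, map_pow, hinc.map_ascInv hp le_rfl, hinc.map_descProd hp le_rfl,
      hinc.2.2 1 le_rfl hp, mul_assoc]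
  rw [h1, tY_pow_mul_gY hp le_rfl (hinc.apply_mem hp _), ← hinc.2.2 p hp le_rfl, ← map_pow,
    ← map_mul, ← mul_assoc, ← mul_assoc, ← map_mul, htr.apply_mul_gY_mul hinc hd hp,
    ← ascInv_mul_tY_pow_mul_descProd hp le_rfl a]
  simp only [mul_assoc]

theorem IsRelTrace.apply_tY_pow_mul_bk_mul_bY (htr : IsRelTrace d x y p inc tr)
    (hinc : IsIncl d p inc) (hd : 1 ≤ d) (hp : 1 ≤ p) (w : YB d p) (a : ℕ) :
    tr (inc w * (tY d (p + 1) (p + 1) ^ a * (bk d (p + 1) (p + 1) * inc (bY d p)))) =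
      y (a : ZMod d) • (w * bY d p) := by
  have c := ((tY_commute_strandAlg le_rfl (hinc.apply_mem hp (bY d p))).pow_left a).eq
  have e : ∀ Y : YB d (p + 1), inc w * (tY d (p + 1) (p + 1) ^ a * (inc (bY d p) * Y)) =
      inc (w * bY d p) * (tY d (p + 1) (p + 1) ^ a * Y) := fun Y => by
    rw [← mul_assoc (_ ^ a), c, map_mul]
    simp only [mul_assoc]
  have c' : Commute ((d : Kf)⁻¹ • ∑ m ∈ Finset.range d,
      tY d p 1 ^ m * tY d p 1 ^ a * tY d p 1 ^ (d - m)) (bY d p) := by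
    have h := tY_commute_bY (d := d) le_rfl hp
    exact Commute.smul_left (Commute.sum_left _ _ _ fun m _ =>
      ((h.pow_left _).mul_left (h.pow_left _)).mul_left (h.pow_left _)) _
  rw [hinc.1, bk_mul_bY hp le_rfl, ← hinc.1]
  simp only [mul_add, mul_sub, mul_smul_comm, map_add, map_sub, map_smul, mul_assoc]
  rw [e, e, htr.apply_tY_pow_mul_bk hd hp, htr.apply_crossTerm hinc hd hp, ← map_mul inc,
    htr.apply_crossTerm hinc hd hp, mul_assoc w, ← c'.eq]
  simp only [mul_assoc, sub_self, smul_zero, add_zero]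

theorem IsRelTrace.map_mul_right_gen (htr : IsRelTrace d x y p inc tr) (hinc : IsIncl d p inc)
    (hd : 1 ≤ d) (hp : 1 ≤ p) {Z : YB d p} (hZ : Z ∈ strandGens d p p) (Y : YB d (p + 1)) :
    tr (Y * inc Z) = tr Y * Z := by
  refine hinc.linearMap_ext (f := tr ∘ₗ LinearMap.mulRight Kf (inc Z))
    (g := LinearMap.mulRight Kf Z ∘ₗ tr) hp (fun w a => ?_) (fun w a => ?_) (fun w w' => ?_) Y
  · have c := ((tY_commute_strandAlg le_rfl (hinc.apply_mem hp Z)).pow_left a).eq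
    simp only [LinearMap.comp_apply, LinearMap.mulRight_apply]
    rw [mul_assoc, c, ← mul_assoc, ← map_mul, htr.apply_tY_pow hd hp, htr.apply_tY_pow hd hp,
      smul_mul_assoc]
  · simp only [LinearMap.comp_apply, LinearMap.mulRight_apply]
    rw [htr.apply_tY_pow_mul_bk hd hp, smul_mul_assoc]
    have aux : Commute (bk d (p + 1) (p + 1)) (inc Z) →
        tr (inc w * (tY d (p + 1) (p + 1) ^ a * bk d (p + 1) (p + 1)) * inc Z) =
          y (a : ZMod d) • (w * Z) := fun hc => by
      have c := (tY_commute_strandAlg le_rfl (hinc.apply_mem hp Z)).pow_left a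
      rw [mul_assoc, (c.mul_left hc).eq, ← mul_assoc, ← map_mul,
        htr.apply_tY_pow_mul_bk hd hp]
    rcases hZ with ⟨_, rfl⟩ | ⟨i, h1, h2, rfl⟩ | ⟨j, h1, h2, rfl⟩
    · rw [mul_assoc, mul_assoc, htr.apply_tY_pow_mul_bk_mul_bY hinc hd hp]
    · refine aux ?_
      rw [hinc.2.1 i h1 (by omega)]
      exact bk_commute_gY h1 h2 le_rfl
    · refine aux ?_
      rw [hinc.2.2 j h1 h2]
      exact (tY_commute_bk (by omega) le_rfl h1 (by omega)).symm
  · simp only [LinearMap.comp_apply, LinearMap.mulRight_apply]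
    rw [mul_assoc, ← map_mul, htr.apply_mul_gY_mul hinc hd hp, htr.apply_mul_gY_mul hinc hd hp,
      smul_mul_assoc, mul_assoc]

theorem IsRelTrace.map_mul_right (htr : IsRelTrace d x y p inc tr) (hinc : IsIncl d p inc)
    (hd : 1 ≤ d) (hp : 1 ≤ p) (Y : YB d (p + 1)) (Z : YB d p) :
    tr (Y * inc Z) = tr Y * Z := by
  have hZ : Z ∈ strandAlg d p p := by rw [strandAlg_self hp]; exact Algebra.mem_top
  induction hZ using Algebra.adjoin_induction generalizing Y with
  | mem h hh => exact htr.map_mul_right_gen hinc hd hp hh Y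
  | algebraMap r =>
    rw [AlgHom.commutes, ← Algebra.commutes, ← Algebra.smul_def, ← Algebra.commutes,
      ← Algebra.smul_def, map_smul]
  | add Z Z' _ _ h h' => rw [map_add, mul_add, map_add, h, h', mul_add]
  | mul Z Z' _ _ h h' => rw [map_mul inc, ← mul_assoc, h', h, mul_assoc]

end RelativeTrace

/-- with `n = p + 1`, so `n ≥ 2`: the relative trace
`tr_n : Y_{d,n}^B → Y_{d,n-1}^B` satisfies `tr_n(YZ) = tr_n(Y)Z`, `tr_n(XY) = X tr_n(Y)`
and `tr_n(XYZ) = X tr_n(Y) Z` for `X, Z ∈ Y_{d,n-1}^B` and `Y ∈ Y_{d,n}^B`. -/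
theorem stmt12 (d p : ℕ) (hd : 1 ≤ d) (hp : 1 ≤ p)
    (x y : ZMod d → Kf) (hx0 : x 0 = 1) (hx : ∀ i, x i ≠ 0) (hy : ∀ i, y i ≠ 0)
    (inc : YB d p →ₐ[Kf] YB d (p + 1)) (hinc : IsIncl d p inc)
    (tr : YB d (p + 1) →ₗ[Kf] YB d p) (htr : IsRelTrace d x y p inc tr) :
    (∀ (Y : YB d (p + 1)) (Z : YB d p), tr (Y * inc Z) = tr Y * Z) ∧
    (∀ (X : YB d p) (Y : YB d (p + 1)), tr (inc X * Y) = X * tr Y) ∧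
    (∀ (X Z : YB d p) (Y : YB d (p + 1)), tr (inc X * Y * inc Z) = X * tr Y * Z) := by
  refine ⟨htr.map_mul_right hinc hd hp, htr.map_mul_left hinc hd hp, fun X Z Y => ?_⟩
  rw [htr.map_mul_right hinc hd hp, htr.map_mul_left hinc hd hp]
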